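/- Let f : ℝⁿ → ℝ be L-smooth and μ-strongly convex (μ ≥ 0) with minimizer x_*. Run AggHB with parameters satisfying 0 < γᵢ ≤ (1 - max_j β_j)(1-βᵢ)/(2μ), βᵢ ∈ [0,1), F = (1/m)∑ᵢ γᵢ/(1-βᵢ) ≤ 1/(4L), and BF ≤ (1 - max_i βᵢ)/(48L²) where B = (1/m)∑ᵢ βᵢγᵢ(1-βᵢ^{K+1})/(1-βᵢ)². Then with weights w_k = (1-μF/2)^{-(k+1)}, W_K = ∑_{k=0}^K w_k, and x̄_K = (1/W_K)∑_{k=0}^K w_k x_k, one has f(x̄_K) - f(x_*) ≤ 4‖x_0 - x_*‖²/(F W_K). -/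

import Mathlib

open scoped RealInnerProductSpace

lemma agg_descent {E : Type*} [NormedAddCommGroup E] [InnerProductSpace ℝ E] [CompleteSpace E]
    (f : E → ℝ) (hf : Differentiable ℝ f) (L : ℝ)
    (hsmooth : ∀ x y, ‖gradient f x - gradient f y‖ ≤ L * ‖x - y‖) (x v : E) :
    f (x + v) ≤ f x + ⟪gradient f x, v⟫ + L / 2 * ‖v‖ ^ 2 := by
  have hd : ∀ t : ℝ, HasDerivAt
      (fun t : ℝ => f (x + t • v) - t * ⟪gradient f x, v⟫ - L / 2 * ‖v‖ ^ 2 * t ^ 2)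
      (⟪gradient f (x + t • v), v⟫ - ⟪gradient f x, v⟫ - L * ‖v‖ ^ 2 * t) t := by
    intro t
    have h1 : HasDerivAt (fun t : ℝ => x + t • v) v t := by
      simpa using ((hasDerivAt_id t).smul_const v).const_add x
    have h2 := (hf (x + t • v)).hasGradientAt.hasFDerivAt.comp_hasDerivAt t h1
    have h3 := (hasDerivAt_id t).mul_const (⟪gradient f x, v⟫)
    have h4 := (hasDerivAt_pow 2 t).const_mul (L / 2 * ‖v‖ ^ 2)
    refine HasDerivAt.congr_deriv ((h2.sub h3).sub h4) ?_
    rw [InnerProductSpace.toDual_apply_apply]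
    push_cast
    ring
  have ha : AntitoneOn
      (fun t : ℝ => f (x + t • v) - t * ⟪gradient f x, v⟫ - L / 2 * ‖v‖ ^ 2 * t ^ 2)
      (Set.Icc 0 1) := by
    apply antitoneOn_of_deriv_nonpos (convex_Icc 0 1)
    · exact fun t _ => (hd t).continuousAt.continuousWithinAt
    · exact fun t _ => (hd t).differentiableAt.differentiableWithinAt
    · intro t ht
      rw [interior_Icc] at ht
      rw [(hd t).deriv, ← inner_sub_left]
      have h1 := real_inner_le_norm (gradient f (x + t • v) - gradient f x) v
      have h2 := hsmooth (x + t • v) x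
      rw [add_sub_cancel_left, norm_smul, Real.norm_of_nonneg ht.1.le] at h2
      nlinarith [mul_le_mul_of_nonneg_right h2 (norm_nonneg v)]
  have h := ha (Set.left_mem_Icc.2 zero_le_one) (Set.right_mem_Icc.2 zero_le_one) zero_le_one
  simp only [zero_smul, one_smul, add_zero] at h
  linarith

lemma agg_grad_sq {E : Type*} [NormedAddCommGroup E] [InnerProductSpace ℝ E] [CompleteSpace E]
    (f : E → ℝ) (hf : Differentiable ℝ f) (L : ℝ) (hL : 0 < L)
    (hsmooth : ∀ x y, ‖gradient f x - gradient f y‖ ≤ L * ‖x - y‖) (xs : E)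
    (hmin : ∀ y, f xs ≤ f y) (x : E) :
    ‖gradient f x‖ ^ 2 ≤ 2 * L * (f x - f xs) := by
  have h := agg_descent f hf L hsmooth x (-(1 / L) • gradient f x)
  have h2 := hmin (x + -(1 / L) • gradient f x)
  rw [inner_smul_right, real_inner_self_eq_norm_sq, norm_smul, mul_pow, Real.norm_eq_abs,
    sq_abs] at h
  have h3 : f xs ≤ f x - 1 / (2 * L) * ‖gradient f x‖ ^ 2 := by
    refine (h2.trans h).trans (le_of_eq ?_)
    field_simp
    ring
  have h4 : ‖gradient f x‖ ^ 2 = 2 * L * (1 / (2 * L) * ‖gradient f x‖ ^ 2) := by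
    field_simp
  rw [h4]
  exact mul_le_mul_of_nonneg_left (by linarith) (by positivity)

/-- weighted geometric convolution -/
lemma agg_conv (a : ℕ → ℝ) (ha : ∀ l, 0 ≤ a l) (b q C : ℝ) (hb : 0 ≤ b) (hq : 0 ≤ q)
    (hC : 0 ≤ C) (h : 1 + C * (q * b) ≤ C) (N : ℕ) :
    ∑ k ∈ Finset.range N, q ^ (k + 1) * (∑ l ∈ Finset.range k, b ^ (k - l) * a l)
      ≤ C * ∑ l ∈ Finset.range N, q ^ (l + 1) * a l := by
  have hS : ∀ k, ∑ l ∈ Finset.range (k + 1), b ^ (k + 1 - l) * a l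
      = b * ((∑ l ∈ Finset.range k, b ^ (k - l) * a l) + a k) := by
    intro k
    rw [Finset.sum_range_succ, mul_add, Finset.mul_sum]
    congr 1
    · apply Finset.sum_congr rfl
      intro l hl
      have := Finset.mem_range.1 hl
      rw [show k + 1 - l = (k - l) + 1 by omega, pow_succ]
      ring
    · simp
  have hS0 : ∀ k, 0 ≤ ∑ l ∈ Finset.range k, b ^ (k - l) * a l := fun k =>
    Finset.sum_nonneg fun l _ => mul_nonneg (pow_nonneg hb _) (ha l)
  have key : ∀ N, ∑ k ∈ Finset.range N, q ^ (k + 1) * (∑ l ∈ Finset.range k, b ^ (k - l) * a l)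
      + C * (q ^ (N + 1) * (∑ l ∈ Finset.range N, b ^ (N - l) * a l))
      ≤ C * ∑ l ∈ Finset.range N, q ^ (l + 1) * a l := by
    intro N
    induction N with
    | zero => simp
    | succ N ih =>
      rw [hS, Finset.sum_range_succ, Finset.sum_range_succ]
      have h0 := hS0 N
      have ha' := ha N
      have hqN : 0 ≤ q ^ (N + 1) := pow_nonneg hq _
      generalize (∑ l ∈ Finset.range N, b ^ (N - l) * a l) = S at *
      rw [pow_succ q (N + 1)]
      generalize q ^ (N + 1) = Q at *
      have h1 := mul_le_mul_of_nonneg_right h (mul_nonneg hqN h0)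
      have h2 := mul_le_mul_of_nonneg_right h (mul_nonneg hqN ha')
      have h3 := mul_nonneg hqN ha'
      nlinarith
  have := key N
  have h1 : 0 ≤ C * (q ^ (N + 1) * (∑ l ∈ Finset.range N, b ^ (N - l) * a l)) :=
    mul_nonneg hC (mul_nonneg (pow_nonneg hq _) (hS0 N))
  linarith

lemma agg_cs {E : Type*} [NormedAddCommGroup E] [InnerProductSpace ℝ E]
    {ι : Type*} (s : Finset ι) (c : ι → ℝ) (hc : ∀ i ∈ s, 0 ≤ c i) (g : ι → E) :
    ‖∑ i ∈ s, c i • g i‖ ^ 2 ≤ (∑ i ∈ s, c i) * ∑ i ∈ s, c i * ‖g i‖ ^ 2 := by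
  have h1 : ‖∑ i ∈ s, c i • g i‖ ≤ ∑ i ∈ s, c i * ‖g i‖ := by
    refine (norm_sum_le _ _).trans (le_of_eq (Finset.sum_congr rfl fun i hi => ?_))
    rw [norm_smul, Real.norm_of_nonneg (hc i hi)]
  refine (pow_le_pow_left₀ (norm_nonneg _) h1 2).trans ?_
  apply Finset.sum_sq_le_sum_mul_sum_of_sq_le_mul
  · exact hc
  · exact fun i hi => mul_nonneg (hc i hi) (sq_nonneg _)
  · intro i _
    exact le_of_eq (by ring)

lemma agg_geom (b : ℝ) (hb : b < 1) (k : ℕ) :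
    ∑ l ∈ Finset.range k, b ^ (k - l) = b * (1 - b ^ k) / (1 - b) := by
  have h : (1 - b) ≠ 0 := by linarith
  induction k with
  | zero => simp
  | succ k ih =>
    have : ∑ l ∈ Finset.range k, b ^ (k + 1 - l) = b * ∑ l ∈ Finset.range k, b ^ (k - l) := by
      rw [Finset.mul_sum]
      apply Finset.sum_congr rfl
      intro l hl
      have := Finset.mem_range.1 hl
      rw [show k + 1 - l = (k - l) + 1 by omega, pow_succ]
      ring
    rw [Finset.sum_range_succ, this, ih]
    simp
    field_simp
    ring

set_option maxHeartbeats 2000000 in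
/-- Theorem 2: convergence of AggHB for `L`-smooth, `μ`-strongly convex
(`μ ≥ 0`) objectives. Under the parameter conditions
`2μγᵢ ≤ (1 - max_j β_j)(1 - βᵢ)`, `F = (1/m)∑ᵢ γᵢ/(1-βᵢ) ≤ 1/(4L)`, and
`BF ≤ (1 - max_i βᵢ)/(48L²)`, the weighted average `x̄_K` satisfies
`f(x̄_K) - f(x_*) ≤ 4‖x_0 - x_*‖²/(F W_K)`. -/
theorem AggHB_convex_convergence {n : ℕ}
    (f : EuclideanSpace ℝ (Fin n) → ℝ) (hf : Differentiable ℝ f)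
    (L μ : ℝ) (hL : 0 < L) (hμ : 0 ≤ μ)
    (hsmooth : ∀ x y, ‖gradient f x - gradient f y‖ ≤ L * ‖x - y‖)
    (hstrconv : ∀ x y, f x + ⟪gradient f x, y - x⟫ + μ / 2 * ‖y - x‖ ^ 2 ≤ f y)
    (xstar : EuclideanSpace ℝ (Fin n)) (hmin : ∀ y, f xstar ≤ f y)
    (m : ℕ) (β γ : Fin (m + 1) → ℝ)
    (hβ : ∀ i, β i ∈ Set.Ico (0 : ℝ) 1) (hγ : ∀ i, 0 < γ i)
    (βmax : ℝ) (hβmax : βmax = Finset.univ.sup' Finset.univ_nonempty β)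
    (hγμ : ∀ i, 2 * μ * γ i ≤ (1 - βmax) * (1 - β i))
    (F : ℝ) (hF : F = (1 / (m + 1 : ℝ)) * ∑ i, γ i / (1 - β i))
    (hF4L : F ≤ 1 / (4 * L))
    (K : ℕ)
    (B : ℝ) (hB : B = (1 / (m + 1 : ℝ)) *
      ∑ i, β i * γ i * (1 - (β i) ^ (K + 1)) / (1 - β i) ^ 2)
    (hBF : B * F ≤ (1 - βmax) / (48 * L ^ 2))
    (x : ℕ → EuclideanSpace ℝ (Fin n)) (V : Fin (m + 1) → ℕ → EuclideanSpace ℝ (Fin n))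
    (hV0 : ∀ i, V i 0 = gradient f (x 0))
    (hV : ∀ i k, V i (k + 1) = β i • V i k + gradient f (x (k + 1)))
    (hx : ∀ k, x (k + 1) = x k - (1 / (m + 1 : ℝ)) • ∑ i, γ i • V i k)
    (w : ℕ → ℝ) (hw : ∀ k, w k = ((1 - μ * F / 2)⁻¹) ^ (k + 1))
    (W : ℝ) (hW : W = ∑ k ∈ Finset.range (K + 1), w k)
    (xbar : EuclideanSpace ℝ (Fin n))
    (hxbar : xbar = (1 / W) • ∑ k ∈ Finset.range (K + 1), w k • x k) :
    f xbar - f xstar ≤ 4 * ‖x 0 - xstar‖ ^ 2 / (F * W) := by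
  have hM : (0 : ℝ) < (m + 1 : ℝ) := by positivity
  have hb1 : ∀ i, 0 < 1 - β i := fun i => by linarith [(hβ i).2]
  have hble : ∀ i, β i ≤ βmax := fun i => by
    rw [hβmax]; exact Finset.le_sup' β (Finset.mem_univ i)
  have hbm1 : 0 < 1 - βmax := by
    have : βmax < 1 := by
      rw [hβmax, Finset.sup'_lt_iff]
      exact fun i _ => (hβ i).2
    linarith
  have hbm0 : 0 ≤ βmax := (hβ 0).1.trans (hble 0)
  have hcpos : ∀ i, 0 < γ i / (1 - β i) := fun i => div_pos (hγ i) (hb1 i)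
  have hFpos : 0 < F := by
    rw [hF]
    exact mul_pos (by positivity) (Finset.sum_pos (fun i _ => hcpos i) Finset.univ_nonempty)
  have hμF : 2 * μ * F ≤ 1 - βmax := by
    have h1 : ∑ i, 2 * μ * (γ i / (1 - β i)) ≤ ∑ _i : Fin (m + 1), (1 - βmax) := by
      apply Finset.sum_le_sum
      intro i _
      rw [← mul_div_assoc, div_le_iff₀ (hb1 i)]
      exact hγμ i
    rw [← Finset.mul_sum] at h1
    simp only [Finset.sum_const, Finset.card_univ, Fintype.card_fin, nsmul_eq_mul] at h1
    push_cast at h1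
    rw [hF]
    calc 2 * μ * (1 / (m + 1 : ℝ) * ∑ i, γ i / (1 - β i))
        = (2 * μ * ∑ i, γ i / (1 - β i)) / (m + 1 : ℝ) := by ring
      _ ≤ 1 - βmax := by rw [div_le_iff₀ hM]; linarith
  have hμF0 : 0 ≤ μ * F := mul_nonneg hμ hFpos.le
  set p : ℝ := 1 - μ * F / 2 with hp
  have hp0 : 0 < p := by linarith
  have hp1 : p ≤ 1 := by linarith
  set q : ℝ := p⁻¹ with hq
  have hq0 : 0 < q := inv_pos.2 hp0
  have hqp : q * p = 1 := inv_mul_cancel₀ hp0.ne'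
  have hw0 : ∀ k, 0 < w k := fun k => by rw [hw]; exact pow_pos hq0 _
  have hW0 : 0 < W := by
    rw [hW]
    exact Finset.sum_pos (fun k _ => hw0 k) ⟨0, Finset.mem_range.2 (Nat.succ_pos K)⟩
  set g : ℕ → EuclideanSpace ℝ (Fin n) := fun k => gradient f (x k) with hg
  set δ : ℕ → ℝ := fun k => f (x k) - f xstar with hδ
  have hδ0 : ∀ k, 0 ≤ δ k := fun k => sub_nonneg.2 (hmin _)
  have hgδ : ∀ k, ‖g k‖ ^ 2 ≤ 2 * L * δ k := fun k =>
    agg_grad_sq f hf L hL hsmooth xstar hmin (x k)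
  -- the error sequence
  set S : Fin (m + 1) → ℕ → EuclideanSpace ℝ (Fin n) :=
    fun i k => ∑ l ∈ Finset.range k, (β i) ^ (k - l) • g l with hS
  have hSs : ∀ i k, S i (k + 1) = β i • (S i k + g k) := by
    intro i k
    simp only [hS]
    rw [Finset.sum_range_succ, smul_add, Finset.smul_sum]
    congr 1
    · apply Finset.sum_congr rfl
      intro l hl
      have := Finset.mem_range.1 hl
      rw [show k + 1 - l = (k - l) + 1 by omega, pow_succ', mul_smul]
    · simp
  have hVS : ∀ i k, V i k = S i k + g k := by
    intro i k
    induction k with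
    | zero => simp [hS, hV0, hg]
    | succ k ih => rw [hV, ih, hSs]
  set e : ℕ → EuclideanSpace ℝ (Fin n) :=
    fun k => (1 / (m + 1 : ℝ)) • ∑ i, (γ i / (1 - β i)) • S i k with he
  have hes : ∀ k, x (k + 1) - e (k + 1) = x k - e k - F • g k := by
    intro k
    have h1 : e (k + 1) + (1 / (m + 1 : ℝ)) • ∑ i, γ i • V i k = e k + F • g k := by
      simp only [he]
      rw [hF, mul_smul, Finset.sum_smul, ← smul_add, ← smul_add, ← Finset.sum_add_distrib,
        ← Finset.sum_add_distrib]
      congr 1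
      apply Finset.sum_congr rfl
      intro i _
      rw [hSs, hVS, smul_smul, ← add_smul, ← smul_add]
      congr 1
      have := (hb1 i).ne'
      field_simp
      ring
    rw [hx k]
    have h2 : e (k + 1) = e k + F • g k - (1 / (m + 1 : ℝ)) • ∑ i, γ i • V i k := by
      rw [← h1]; abel
    rw [h2]; abel
  have he0 : e 0 = 0 := by simp [he, hS]
  -- coefficient form
  set c : ℕ → ℝ := fun j => (1 / (m + 1 : ℝ)) * ∑ i, γ i / (1 - β i) * (β i) ^ j with hc
  have hc0 : ∀ j, 0 ≤ c j := fun j => mul_nonneg (by positivity)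
    (Finset.sum_nonneg fun i _ => mul_nonneg (hcpos i).le (pow_nonneg (hβ i).1 _))
  have hec : ∀ k, e k = ∑ l ∈ Finset.range k, c (k - l) • g l := by
    intro k
    simp only [he, hS, hc, Finset.smul_sum, Finset.mul_sum, Finset.sum_smul, smul_smul]
    rw [Finset.sum_comm]
  have hcsum : ∀ (a : ℕ → ℝ) k, ∑ l ∈ Finset.range k, c (k - l) * a l
      = (1 / (m + 1 : ℝ)) * ∑ i, γ i / (1 - β i) * ∑ l ∈ Finset.range k, (β i) ^ (k - l) * a l := by
    intro a k
    simp only [hc, Finset.mul_sum, Finset.sum_mul]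
    rw [Finset.sum_comm]
    apply Finset.sum_congr rfl
    intro l _
    apply Finset.sum_congr rfl
    intro i _
    ring
  have hcB : ∀ k, k ≤ K → ∑ l ∈ Finset.range k, c (k - l) ≤ B := by
    intro k hk
    have h1 := hcsum (fun _ => 1) k
    simp only [mul_one] at h1
    rw [h1, hB]
    apply mul_le_mul_of_nonneg_left _ (by positivity)
    apply Finset.sum_le_sum
    intro i _
    rw [agg_geom _ (hβ i).2, div_mul_div_comm, ← sq]
    apply div_le_div_of_nonneg_right _ (sq_nonneg _)
    have h2 : (β i) ^ (K + 1) ≤ (β i) ^ k :=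
      pow_le_pow_of_le_one (hβ i).1 (hβ i).2.le (by omega)
    have h3 := mul_nonneg (hβ i).1 (hγ i).le
    nlinarith [mul_le_mul_of_nonneg_left h2 h3]
  have hB0 : 0 ≤ B := by
    have := hcB 0 (Nat.zero_le _)
    simpa using this
  have hed : ∀ k, k ≤ K → ‖e k‖ ^ 2 ≤ B * ∑ l ∈ Finset.range k, c (k - l) * ‖g l‖ ^ 2 := by
    intro k hk
    rw [hec]
    refine (agg_cs _ (fun l => c (k - l)) (fun l _ => hc0 _) g).trans ?_
    exact mul_le_mul_of_nonneg_right (hcB k hk)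
      (Finset.sum_nonneg fun l _ => mul_nonneg (hc0 _) (sq_nonneg _))
  set C : ℝ := 4 / (3 * (1 - βmax)) with hC
  have hC0 : 0 < C := by positivity
  have hCb : ∀ i, 1 + C * (q * β i) ≤ C := by
    intro i
    have h1 : C * (p - β i) ≥ 1 := by
      have h2 : 3 / 4 * (1 - βmax) ≤ p - β i := by linarith [hble i]
      have h3 : C * (3 / 4 * (1 - βmax)) = 1 := by rw [hC]; field_simp
      linarith [mul_le_mul_of_nonneg_left h2 hC0.le]
    have h4 : p * (1 + C * (q * β i)) ≤ p * C := by
      have : p * (1 + C * (q * β i)) = p + C * β i * (q * p) := by ring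
      rw [this, hqp]
      linarith
    exact le_of_mul_le_mul_left h4 hp0
  have hconv : ∑ k ∈ Finset.range (K + 1), w k * ‖e k‖ ^ 2
      ≤ B * (F * (C * ∑ l ∈ Finset.range (K + 1), w l * ‖g l‖ ^ 2)) := by
    calc ∑ k ∈ Finset.range (K + 1), w k * ‖e k‖ ^ 2
        ≤ ∑ k ∈ Finset.range (K + 1), w k *
            (B * ∑ l ∈ Finset.range k, c (k - l) * ‖g l‖ ^ 2) := by
          apply Finset.sum_le_sum
          intro k hk
          exact mul_le_mul_of_nonneg_left (hed k (by have := Finset.mem_range.1 hk; omega))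
            (hw0 k).le
      _ = B * ((1 / (m + 1 : ℝ)) * ∑ i, γ i / (1 - β i) * ∑ k ∈ Finset.range (K + 1),
            q ^ (k + 1) * ∑ l ∈ Finset.range k, (β i) ^ (k - l) * ‖g l‖ ^ 2) := by
          have : ∀ k, ∑ l ∈ Finset.range k, c (k - l) * ‖g l‖ ^ 2 = _ :=
            fun k => hcsum (fun l => ‖g l‖ ^ 2) k
          simp only [this, hw]
          simp only [Finset.mul_sum (s := (Finset.univ : Finset (Fin (m + 1))))]
          rw [Finset.sum_comm]
          apply Finset.sum_congr rfl
          intro i _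
          rw [Finset.mul_sum, Finset.mul_sum, Finset.mul_sum]
          apply Finset.sum_congr rfl
          intro k _
          ring
      _ ≤ B * ((1 / (m + 1 : ℝ)) * ∑ i, γ i / (1 - β i) *
            (C * ∑ l ∈ Finset.range (K + 1), w l * ‖g l‖ ^ 2)) := by
          apply mul_le_mul_of_nonneg_left _ hB0
          apply mul_le_mul_of_nonneg_left _ (by positivity)
          apply Finset.sum_le_sum
          intro i _
          apply mul_le_mul_of_nonneg_left _ (hcpos i).le
          simp only [hw]
          exact agg_conv (fun l => ‖g l‖ ^ 2) (fun l => sq_nonneg _) (β i) q C (hβ i).1 hq0.le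
            hC0.le (hCb i) (K + 1)
      _ = _ := by
          rw [← Finset.sum_mul, hF]
          ring
  set D : ℝ := ∑ k ∈ Finset.range (K + 1), w k * δ k with hD
  have hD0 : 0 ≤ D := Finset.sum_nonneg fun k _ => mul_nonneg (hw0 k).le (hδ0 k)
  have hgD : ∑ l ∈ Finset.range (K + 1), w l * ‖g l‖ ^ 2 ≤ 2 * L * D := by
    rw [hD, Finset.mul_sum]
    apply Finset.sum_le_sum
    intro k _
    have := mul_le_mul_of_nonneg_left (hgδ k) (hw0 k).le
    linarith
  have heD : 3 * L * ∑ k ∈ Finset.range (K + 1), w k * ‖e k‖ ^ 2 ≤ 1 / 4 * D := by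
    have h1 : B * F * C ≤ 1 / (36 * L ^ 2) := by
      refine (mul_le_mul_of_nonneg_right hBF hC0.le).trans (le_of_eq ?_)
      rw [hC]; field_simp; norm_num
    have h2 : ∑ k ∈ Finset.range (K + 1), w k * ‖e k‖ ^ 2 ≤ 1 / (36 * L ^ 2) * (2 * L * D) := by
      refine hconv.trans ?_
      rw [← mul_assoc, ← mul_assoc]
      refine (mul_le_mul_of_nonneg_left hgD
        (mul_nonneg (mul_nonneg hB0 hFpos.le) hC0.le)).trans ?_
      exact mul_le_mul_of_nonneg_right h1 (by positivity)
    have h3 : 3 * L * (1 / (36 * L ^ 2) * (2 * L * D)) = 1 / 6 * D := by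
      field_simp; ring
    have h4 := mul_le_mul_of_nonneg_left h2 (show 0 ≤ 3 * L by positivity)
    linarith
  -- one step
  set r : ℕ → ℝ := fun k => ‖x k - e k - xstar‖ ^ 2 with hr
  have hstep : ∀ k, r (k + 1) ≤ p * r k - F / 2 * δ k + 3 * L * F * ‖e k‖ ^ 2 := by
    intro k
    have h0 : r (k + 1) = r k - 2 * F * ⟪x k - e k - xstar, g k⟫ + F ^ 2 * ‖g k‖ ^ 2 := by
      simp only [hr]
      rw [hes, show x k - e k - F • g k - xstar = (x k - e k - xstar) - F • g k by abel,
        norm_sub_sq_real, inner_smul_right, norm_smul, mul_pow, Real.norm_eq_abs, sq_abs]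
      ring
    have h1 : ⟪x k - e k - xstar, g k⟫ = ⟪x k - xstar, g k⟫ - ⟪e k, g k⟫ := by
      rw [← inner_sub_left]; congr 1; abel
    have h2 : δ k + μ / 2 * ‖x k - xstar‖ ^ 2 ≤ ⟪x k - xstar, g k⟫ := by
      have := hstrconv (x k) xstar
      rw [norm_sub_rev, ← neg_sub (x k) xstar, inner_neg_right, real_inner_comm] at this
      simp only [hδ, hg]
      linarith
    have h3 : r k ≤ 2 * ‖x k - xstar‖ ^ 2 + 2 * ‖e k‖ ^ 2 := by
      simp only [hr]
      rw [show x k - e k - xstar = (x k - xstar) - e k by abel]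
      have := parallelogram_law_with_norm ℝ (x k - xstar) (e k)
      nlinarith [mul_self_nonneg ‖x k - xstar + e k‖]
    have h4 : 2 * ⟪e k, g k⟫ ≤ 2 * L * ‖e k‖ ^ 2 + δ k := by
      have ha := real_inner_le_norm (e k) (g k)
      have hb := hgδ k
      have hc' : 2 * L * (2 * (‖e k‖ * ‖g k‖)) ≤ 2 * L * (2 * L * ‖e k‖ ^ 2 + δ k) := by
        linarith [sq_nonneg (2 * L * ‖e k‖ - ‖g k‖)]
      have := le_of_mul_le_mul_left hc' (by positivity)
      linarith
    have h5 : μ * ‖e k‖ ^ 2 ≤ L * ‖e k‖ ^ 2 := by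
      have ha := hstrconv (x k) (x k + e k)
      have hb := hstrconv (x k + e k) (x k)
      have hc' := hsmooth (x k + e k) (x k)
      rw [add_sub_cancel_left] at ha hc'
      rw [sub_add_cancel_left, inner_neg_right, norm_neg] at hb
      have hd := real_inner_le_norm (gradient f (x k + e k) - gradient f (x k)) (e k)
      rw [inner_sub_left] at hd
      nlinarith [mul_le_mul_of_nonneg_right hc' (norm_nonneg (e k))]
    have h6 : F ^ 2 * ‖g k‖ ^ 2 ≤ F / 2 * δ k := by
      have hFL : F * (4 * L) ≤ 1 := by rwa [le_div_iff₀ (by positivity)] at hF4L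
      have ha := mul_le_mul_of_nonneg_left (hgδ k) (sq_nonneg F)
      have hb := mul_le_mul_of_nonneg_right hFL (mul_nonneg hFpos.le (hδ0 k))
      nlinarith
    have h2' := mul_le_mul_of_nonneg_left h2 (show 0 ≤ 2 * F by positivity)
    have h3' := mul_le_mul_of_nonneg_left h3 hμF0
    have h4' := mul_le_mul_of_nonneg_left h4 hFpos.le
    have h5' := mul_le_mul_of_nonneg_left h5 hFpos.le
    rw [h0, h1, hp]
    linarith
  have htel : ∀ N, q ^ N * r N + F / 2 * ∑ k ∈ Finset.range N, w k * δ k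
      ≤ r 0 + 3 * L * F * ∑ k ∈ Finset.range N, w k * ‖e k‖ ^ 2 := by
    intro N
    induction N with
    | zero => simp
    | succ N ih =>
      rw [Finset.sum_range_succ, Finset.sum_range_succ]
      have h1 := mul_le_mul_of_nonneg_left (hstep N) (hw0 N).le
      have h2 : w N * (p * r N) = q ^ N * r N := by
        rw [hw, pow_succ, ← mul_assoc, mul_assoc (q ^ N), hqp, mul_one]
      have h3 : q ^ (N + 1) = w N := (hw N).symm
      rw [h3]
      linarith
  have hr0 : r 0 = ‖x 0 - xstar‖ ^ 2 := by simp [hr, he0]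
  have hmain : F / 4 * D ≤ ‖x 0 - xstar‖ ^ 2 := by
    have h1 := htel (K + 1)
    have h2 := mul_le_mul_of_nonneg_left heD hFpos.le
    have h3 : 0 ≤ q ^ (K + 1) * r (K + 1) := mul_nonneg (pow_nonneg hq0.le _) (sq_nonneg _)
    rw [hr0] at h1
    linarith
  -- Jensen
  have hJ : W * (f xbar - f xstar) ≤ D := by
    have h1 : ∑ k ∈ Finset.range (K + 1), w k • (x k - xbar) = 0 := by
      simp only [smul_sub, Finset.sum_sub_distrib]
      rw [← Finset.sum_smul, ← hW, hxbar, smul_smul, mul_one_div_cancel hW0.ne', one_smul,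
        sub_self]
    have h2 : ∑ k ∈ Finset.range (K + 1), w k * ⟪gradient f xbar, x k - xbar⟫ = 0 := by
      have := congrArg (fun z => ⟪gradient f xbar, z⟫) h1
      simpa only [inner_sum, inner_smul_right, inner_zero_right] using this
    have h3 : ∑ k ∈ Finset.range (K + 1),
        w k * ((f xbar - f xstar) + ⟪gradient f xbar, x k - xbar⟫) ≤ D := by
      rw [hD]
      apply Finset.sum_le_sum
      intro k _
      apply mul_le_mul_of_nonneg_left _ (hw0 k).le
      have ha := hstrconv xbar (x k)
      have hb : 0 ≤ μ / 2 * ‖x k - xbar‖ ^ 2 := by positivity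
      simp only [hδ]
      linarith
    simp only [mul_add, Finset.sum_add_distrib] at h3
    rw [h2, add_zero, ← Finset.sum_mul, ← hW] at h3
    exact h3
  rw [le_div_iff₀ (mul_pos hFpos hW0)]
  have := mul_le_mul_of_nonneg_left hJ hFpos.le
  linarith
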